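/- Let N and f be odd positive integers, α ≥ 1 an integer, and ℓ an odd prime with ℓ | N and ℓ ∤ f. Then c_{N,f}(ℓ^α) = ℓ^{α−1}·(ℓ−2). -/

import Mathlib

open scoped Classical BigOperators

noncomputable section

/-- the modulus ℓ^e with e = ν_ℓ(4nf²) -/
def CNlMod (n f ℓ : ℕ) : ℕ := ℓ ^ ((4 * n * f ^ 2).factorization ℓ)

/-- #C_N^{(ℓ)}(a,n,f): the number of z ∈ (ℤ/ℓ^eℤ)^*, e = ν_ℓ(4nf²),
with D_N(z) ≡ af² (mod ℓ^e) -/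
def CNl (N a n f ℓ : ℕ) : ℕ :=
  Nat.card {z : (ZMod (CNlMod n f ℓ))ˣ //
    ((z : ZMod (CNlMod n f ℓ))) ^ 2
        - 2 * ((N : ZMod (CNlMod n f ℓ)) + 1) * ((z : ZMod (CNlMod n f ℓ)))
        + ((N : ZMod (CNlMod n f ℓ)) - 1) ^ 2
      = (a : ZMod (CNlMod n f ℓ)) * (f : ZMod (CNlMod n f ℓ)) ^ 2}

/-- the odd part of n -/
def oddPart (n : ℕ) : ℕ := n / 2 ^ (n.factorization 2)

/-- 𝒮₂(n,a) = 1 if n odd, 2 if n even and a ≡ 5 (8), 0 otherwise -/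
def S2 (n a : ℕ) : ℤ := if Odd n then 1 else if a % 8 = 5 then 2 else 0

/-- c_{N,f}(n) = ∑_{a ∈ (ℤ/4nℤ)^*, a ≡ 1 (4)} (a/n')·𝒮₂(n,a)·∏_{ℓ ∣ n'} #C_N^{(ℓ)}(a,n,f),
where n' is the odd part of n -/
def cNf (N f n : ℕ) : ℤ :=
  ∑ a ∈ (Finset.range (4 * n)).filter (fun a => a % 4 = 1 ∧ a.Coprime (4 * n)),
    jacobiSym (a : ℤ) (oddPart n) * S2 n a *
      ∏ ℓ ∈ (oddPart n).primeFactors, (CNl N a n f ℓ : ℤ)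

theorem CNlMod_prime_pow {f ℓ α : ℕ} (hf0 : 0 < f) (hℓ : ℓ.Prime) (hℓodd : Odd ℓ)
    (hℓf : ¬ ℓ ∣ f) : CNlMod (ℓ ^ α) f ℓ = ℓ ^ α := by
  have h4 : ¬ ℓ ∣ 4 := by
    intro h
    have h2 : ℓ ∣ 2 := hℓ.dvd_of_dvd_pow (n := 2) h
    rw [Nat.prime_dvd_prime_iff_eq hℓ Nat.prime_two] at h2
    subst h2
    exact absurd hℓodd (by decide)
  have hpow : ℓ ^ α ≠ 0 := pow_ne_zero _ hℓ.ne_zero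
  unfold CNlMod
  rw [Nat.factorization_mul (mul_ne_zero (by norm_num) hpow) (pow_ne_zero _ hf0.ne'),
    Nat.factorization_mul (by norm_num) hpow]
  simp [Nat.factorization_eq_zero_of_not_dvd h4, Nat.factorization_eq_zero_of_not_dvd hℓf,
    hℓ.factorization_self]

theorem oddPart_of_odd {n : ℕ} (hn : Odd n) : oddPart n = n := by
  have : ¬ 2 ∣ n := hn.not_two_dvd_nat
  simp [oddPart, Nat.factorization_eq_zero_of_not_dvd this]

theorem CNl_eq_sum {N a m f ℓ : ℕ} [NeZero m] (hm : CNlMod m f ℓ = m) :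
    (CNl N a m f ℓ : ℤ) = ∑ z : (ZMod m)ˣ,
      if (z : ZMod m) ^ 2 - 2 * ((N : ZMod m) + 1) * z + ((N : ZMod m) - 1) ^ 2
        = (a : ZMod m) * (f : ZMod m) ^ 2 then 1 else 0 := by
  unfold CNl
  rw [hm, Nat.card_eq_fintype_card, Fintype.card_subtype, Finset.sum_boole]

/-- The discriminant polynomial reduces to `(z - 1) ^ 2` modulo a divisor of `N`. -/
theorem map_discr_of_dvd {N ℓ m : ℕ} (hℓN : ℓ ∣ N) (π : ZMod m →+* ZMod ℓ) (z : ZMod m) :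
    π (z ^ 2 - 2 * ((N : ZMod m) + 1) * z + ((N : ZMod m) - 1) ^ 2) = (π z - 1) ^ 2 := by
  have h : (N : ZMod ℓ) = 0 := (ZMod.natCast_eq_zero_iff _ _).2 hℓN
  simp only [map_add, map_sub, map_mul, map_pow, map_natCast, map_one, map_ofNat, h]
  ring

theorem card_units_unitsMap_ne_one {ℓ α : ℕ} (hα : 1 ≤ α) (hℓ : ℓ.Prime) [NeZero (ℓ ^ α)] :
    ((Finset.univ.filter fun z : (ZMod (ℓ ^ α))ˣ =>
      ZMod.unitsMap (dvd_pow_self ℓ (by omega : α ≠ 0)) z ≠ 1).card : ℤ)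
      = (ℓ : ℤ) ^ (α - 1) * ((ℓ : ℤ) - 2) := by
  have : Fact ℓ.Prime := ⟨hℓ⟩
  set φ := ZMod.unitsMap (dvd_pow_self ℓ (by omega : α ≠ 0)) with hφ
  have hsurj : Function.Surjective φ := ZMod.unitsMap_surjective _
  have hcard := φ.ker.card_mul_index
  rw [Subgroup.index_ker, MonoidHom.range_eq_top.2 hsurj, Subgroup.card_top,
    Nat.card_eq_fintype_card (α := (ZMod ℓ)ˣ), Nat.card_eq_fintype_card (α := (ZMod (ℓ ^ α))ˣ),
    ZMod.card_units_eq_totient, ZMod.card_units_eq_totient, Nat.totient_prime hℓ,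
    Nat.totient_prime_pow hℓ (by omega)] at hcard
  have hker := Nat.eq_of_mul_eq_mul_right (Nat.sub_pos_of_lt hℓ.one_lt) hcard
  have hker' : (Finset.univ.filter fun z => φ z = 1).card = ℓ ^ (α - 1) := by
    rw [← hker, Nat.card_eq_fintype_card, Fintype.card_subtype]
    congr 1
    ext z
    simp [MonoidHom.mem_ker]
  have hsum := Finset.card_filter_add_card_filter_not (s := Finset.univ) (fun z => φ z = 1)
  rw [hker', Finset.card_univ, ZMod.card_units_eq_totient,
    Nat.totient_prime_pow hℓ (by omega)] at hsum
  have h1 := hℓ.one_lt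
  zify [h1.le] at hsum
  simp only [ne_eq]
  linarith

/-- Lemma 4 (`compute factors of c`): c_{N,f}(ℓ^α) = ℓ^{α−1}(ℓ−2) for an odd prime
ℓ ∣ N with ℓ ∤ f. -/
theorem cNf_ell_pow_dvd_N (N f ℓ α : ℕ) (hN : Odd N) (hN0 : 0 < N) (hf : Odd f)
    (hf0 : 0 < f) (hα : 1 ≤ α) (hℓ : ℓ.Prime) (hℓodd : Odd ℓ) (hℓN : ℓ ∣ N)
    (hℓf : ¬ ℓ ∣ f) :
    cNf N f (ℓ ^ α) = (ℓ : ℤ) ^ (α - 1) * ((ℓ : ℤ) - 2) := by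
  have : Fact ℓ.Prime := ⟨hℓ⟩
  have : NeZero (ℓ ^ α) := ⟨pow_ne_zero _ hℓ.ne_zero⟩
  have hα0 : α ≠ 0 := by omega
  have hodd : Odd (ℓ ^ α) := hℓodd.pow
  have hdvd : ℓ ∣ ℓ ^ α := dvd_pow_self ℓ hα0
  have hco4 : Nat.Coprime 4 (ℓ ^ α) := (Nat.coprime_two_left.2 hodd).pow_left 2
  have hfco : Nat.Coprime f (ℓ ^ α) := ((hℓ.coprime_iff_not_dvd.2 hℓf).symm).pow_right α
  set π := ZMod.castHom hdvd (ZMod ℓ) with hπ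
  have hfℓ : (f : ZMod ℓ) ≠ 0 := by rwa [Ne, ZMod.natCast_eq_zero_iff]
  have hterm : ∀ a ∈ (Finset.range (4 * ℓ ^ α)).filter
      (fun a => a % 4 = 1 ∧ a.Coprime (4 * ℓ ^ α)),
      jacobiSym (a : ℤ) (oddPart (ℓ ^ α)) * S2 (ℓ ^ α) a *
        ∏ p ∈ (oddPart (ℓ ^ α)).primeFactors, (CNl N a (ℓ ^ α) f p : ℤ)
      = ∑ z : (ZMod (ℓ ^ α))ˣ,
        if (z : ZMod (ℓ ^ α)) ^ 2 - 2 * ((N : ZMod (ℓ ^ α)) + 1) * z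
          + ((N : ZMod (ℓ ^ α)) - 1) ^ 2
          = (a : ZMod (ℓ ^ α)) * (f : ZMod (ℓ ^ α)) ^ 2 then (1 : ℤ) else 0 := by
    intro a ha
    simp only [Finset.mem_filter, Finset.mem_range] at ha
    rw [oddPart_of_odd hodd, Nat.primeFactors_prime_pow hα0 hℓ, Finset.prod_singleton,
      CNl_eq_sum (CNlMod_prime_pow hf0 hℓ hℓodd hℓf), S2, if_pos hodd, mul_one, Finset.mul_sum]
    refine Finset.sum_congr rfl fun z _ => ?_
    split_ifs with h
    · have h' := congrArg π h
      rw [map_discr_of_dvd hℓN π, map_mul, map_pow, map_natCast, map_natCast] at h'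
      have haℓ : (a : ZMod ℓ) ≠ 0 := by
        rw [Ne, ZMod.natCast_eq_zero_iff]
        intro hd
        exact hℓ.one_lt.ne' (Nat.dvd_one.1 (ha.2.2 ▸ Nat.dvd_gcd hd (hdvd.mul_left 4)))
      have hleg : legendreSym ℓ (a : ℤ) = 1 := by
        rw [legendreSym.eq_one_iff ℓ (by exact_mod_cast haℓ)]
        refine ⟨(π z - 1) / f, ?_⟩
        field_simp
        push_cast
        rw [h']
      rw [jacobiSym.pow_right, ← jacobiSym.legendreSym.to_jacobiSym, hleg, one_pow, one_mul]
    · simp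
  unfold cNf
  rw [Finset.sum_congr rfl hterm, Finset.sum_comm, ← card_units_unitsMap_ne_one hα hℓ,
    ← Finset.sum_boole]
  refine Finset.sum_congr rfl fun z _ => ?_
  set D := (z : ZMod (ℓ ^ α)) ^ 2 - 2 * ((N : ZMod (ℓ ^ α)) + 1) * z
          + ((N : ZMod (ℓ ^ α)) - 1) ^ 2 with hD
  have hπD : π D = (π z - 1) ^ 2 := map_discr_of_dvd hℓN π _
  have hz : ZMod.unitsMap hdvd z = 1 ↔ π z = 1 := by
    rw [Units.ext_iff]; rfl
  have hfu : IsUnit ((f : ZMod (ℓ ^ α)) ^ 2) :=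
    ((ZMod.isUnit_iff_coprime f (ℓ ^ α)).2 hfco).pow 2
  split_ifs with hne
  · rw [Ne, hz] at hne
    have hpos : 0 < 4 * ℓ ^ α := by have := hℓ.pos; positivity
    obtain ⟨u, hu⟩ := hfu
    obtain ⟨b, hb4, hbD⟩ := Nat.chineseRemainder hco4 1 (D * (u⁻¹ : (ZMod (ℓ ^ α))ˣ)).val
    have hab4 : b % (4 * ℓ ^ α) % 4 = 1 := by
      rw [Nat.mod_mul_right_mod]; exact hb4
    have haD : ((b % (4 * ℓ ^ α) : ℕ) : ZMod (ℓ ^ α)) = D * (u⁻¹ : (ZMod (ℓ ^ α))ˣ) := by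
      rw [← ZMod.natCast_zmod_val (D * ((u⁻¹ : (ZMod (ℓ ^ α))ˣ) : ZMod (ℓ ^ α))), ZMod.natCast_eq_natCast_iff]
      exact ((Nat.mod_modEq b _).of_mul_left 4).trans hbD
    have halt : b % (4 * ℓ ^ α) < 4 * ℓ ^ α := Nat.mod_lt _ hpos
    generalize b % (4 * ℓ ^ α) = a at hab4 haD halt
    have haeq : D = (a : ZMod (ℓ ^ α)) * (f : ZMod (ℓ ^ α)) ^ 2 := by
      rw [haD, ← hu, mul_assoc, Units.inv_mul, mul_one]
    have haℓ : ¬ ℓ ∣ a := by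
      intro hd
      rw [← ZMod.natCast_eq_zero_iff] at hd
      have h' := congrArg π haeq
      rw [hπD, map_mul, map_pow, map_natCast, map_natCast, hd, zero_mul] at h'
      exact hne (sub_eq_zero.1 (pow_eq_zero_iff two_ne_zero |>.1 h'))
    have haco : a.Coprime (4 * ℓ ^ α) := by
      refine Nat.Coprime.mul_right ?_ ((hℓ.coprime_iff_not_dvd.2 haℓ).symm.pow_right α)
      exact (Nat.coprime_two_right.2 (Nat.odd_iff.2 (by omega))).pow_right 2
    rw [Finset.sum_eq_single a, if_pos haeq]
    · intro c hc hca
      simp only [Finset.mem_filter, Finset.mem_range] at hc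
      refine if_neg fun h => hca ?_
      rw [haeq, ← hu, Units.mul_left_inj, ZMod.natCast_eq_natCast_iff] at h
      have h4 : c ≡ a [MOD 4] := hc.2.1.trans hab4.symm
      exact ((Nat.modEq_and_modEq_iff_modEq_mul hco4).1 ⟨h4, h.symm⟩).eq_of_lt_of_lt hc.1 halt
    · intro hnot
      exact absurd (Finset.mem_filter.2 ⟨Finset.mem_range.2 halt, hab4, haco⟩) hnot
  · rw [Ne, not_not, hz] at hne
    refine Finset.sum_eq_zero fun a ha => if_neg fun h => ?_
    simp only [Finset.mem_filter, Finset.mem_range] at ha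
    have h' := congrArg π h
    rw [hπD, map_mul, map_pow, map_natCast, map_natCast, hne, sub_self, zero_pow two_ne_zero] at h'
    have := (mul_eq_zero.1 h'.symm).resolve_right (pow_ne_zero 2 hfℓ)
    rw [ZMod.natCast_eq_zero_iff] at this
    exact hℓ.one_lt.ne' (Nat.dvd_one.1 (ha.2.2 ▸ Nat.dvd_gcd this (hdvd.mul_left 4)))
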